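/- arXiv:1610.07101 — 3 statements merged into one kernel-verified Lean document; each statement's English description precedes it below -/
import Mathlib

section
/- (Newman–Wright inequality) Let X₁, …, X_n be associated real random variables with finite variances, and let ψ_{(X₁,…,X_n)}(t) = E exp(i(t₁X₁ + ⋯ + t_nX_n)) denote their joint characteristic function and ψ_{X_j}(t_j) = E exp(i t_j X_j) the marginal characteristic functions. Then for every t = (t₁,…,t_n) ∈ ℝⁿ, | ψ_{(X₁,…,X_n)}(t) − ∏_{j=1}^{n} ψ_{X_j}(t_j) | ≤ (1/2)·∑_{1 ≤ i ≠ j ≤ n} |t_i t_j| · Cov(X_i, X_j). -/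
open MeasureTheory ProbabilityTheory Filter Topology

noncomputable section

/-- Covariance of two real random variables: `Cov(X,Y) = E(XY) - E(X)E(Y)`. -/
def cov {Ω : Type*} [MeasurableSpace Ω] (μ : Measure Ω) (X Y : Ω → ℝ) : ℝ :=
  (∫ ω, X ω * Y ω ∂μ) - (∫ ω, X ω ∂μ) * (∫ ω, Y ω ∂μ)

/-- A function `h : ℝⁿ → ℝ` is coordinatewise nondecreasing. -/
def CoordwiseMono {n : ℕ} (h : (Fin n → ℝ) → ℝ) : Prop :=
  ∀ x y : Fin n → ℝ, (∀ i, x i ≤ y i) → h x ≤ h y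

/-- A finite family `(X₁,…,Xₙ)` of real random variables is associated if for all
coordinatewise nondecreasing `h, g` for which the covariance exists,
`Cov(h(X₁,…,Xₙ), g(X₁,…,Xₙ)) ≥ 0`. -/
def IsAssociated {Ω : Type*} [MeasurableSpace Ω] (μ : Measure Ω) {n : ℕ}
    (X : Fin n → Ω → ℝ) : Prop :=
  ∀ h g : (Fin n → ℝ) → ℝ, CoordwiseMono h → CoordwiseMono g →
    Integrable (fun ω => h (fun i => X i ω)) μ →
    Integrable (fun ω => g (fun i => X i ω)) μ →
    Integrable (fun ω => h (fun i => X i ω) * g (fun i => X i ω)) μ →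
    0 ≤ cov μ (fun ω => h (fun i => X i ω)) (fun ω => g (fun i => X i ω))

/-- An infinite sequence of real random variables is associated if every finite
subfamily is associated. -/
def IsAssociatedSeq {Ω : Type*} [MeasurableSpace Ω] (μ : Measure Ω) (X : ℕ → Ω → ℝ) : Prop :=
  ∀ (k : ℕ) (φ : Fin k → ℕ), IsAssociated μ (fun i => X (φ i))

/-- Convergence in distribution of a sequence of real random variables to a law `ν`:
integrals of bounded continuous functions converge. -/
def TendstoInDistrib {Ω : Type*} [MeasurableSpace Ω] (μ : Measure Ω)
    (Z : ℕ → Ω → ℝ) (ν : Measure ℝ) : Prop :=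
  ∀ f : ℝ → ℝ, Continuous f → (∃ C, ∀ x, |f x| ≤ C) →
    Tendsto (fun n => ∫ ω, f (Z n ω) ∂μ) atTop (𝓝 (∫ x, f x ∂ν))

/-- signed kernel: `ker a y = 1_{y ≤ a} - 1_{y ≤ 0}`. -/
def nwKer (a y : ℝ) : ℝ := (if y ≤ a then 1 else 0) - (if y ≤ 0 then 1 else 0)

lemma nwKer_mono (y : ℝ) : Monotone (fun a => nwKer a y) := by
  intro a b h
  simp only [nwKer]
  split_ifs <;> linarith

lemma nwKer_abs_le (a y : ℝ) : |nwKer a y| ≤ 1 := by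
  simp only [nwKer]
  split_ifs <;> norm_num

lemma nwKer_abs (a : ℝ) : (fun y => |nwKer a y|) = (Set.uIoc 0 a).indicator (fun _ => (1:ℝ)) := by
  ext y
  simp only [nwKer, Set.indicator, Set.mem_uIoc]
  split_ifs <;> simp <;> grind

lemma nwKer_eq (a y : ℝ) : nwKer a y =
    (Set.Ioc 0 a).indicator (fun _ => (1:ℝ)) y - (Set.Ioc a 0).indicator (fun _ => (1:ℝ)) y := by
  simp only [nwKer, Set.indicator, Set.mem_Ioc]
  split_ifs <;> simp <;> grind

lemma nwKer_measurable : Measurable (fun p : ℝ × ℝ => nwKer p.1 p.2) := by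
  unfold nwKer
  refine Measurable.sub (Measurable.ite ?_ measurable_const measurable_const)
    (Measurable.ite ?_ measurable_const measurable_const)
  · exact measurableSet_le measurable_snd measurable_fst
  · exact measurableSet_le measurable_snd measurable_const

lemma nwKer_abs_integral (a : ℝ) : ∫ y, |nwKer a y| = |a| := by
  rw [nwKer_abs, integral_indicator measurableSet_uIoc]
  simp [Measure.real, Real.volume_uIoc]

lemma nwKer_abs_integrable (a : ℝ) : Integrable (fun y => |nwKer a y|) := by
  rw [nwKer_abs, integrable_indicator_iff measurableSet_uIoc]
  simp [Real.volume_uIoc]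

lemma nwKer_integral {𝕜 : Type*} [RCLike 𝕜] (a : ℝ) (φ : ℝ → 𝕜) (hφ : Continuous φ) :
    ∫ y, nwKer a y • φ y = ∫ y in (0:ℝ)..a, φ y := by
  rw [intervalIntegral, ← integral_indicator measurableSet_Ioc,
    ← integral_indicator measurableSet_Ioc, ← integral_sub]
  · congr 1
    ext y
    rw [nwKer_eq, sub_smul]
    simp only [Set.indicator]
    split_ifs <;> simp
  · rw [integrable_indicator_iff measurableSet_Ioc]
    exact hφ.integrableOn_Ioc
  · rw [integrable_indicator_iff measurableSet_Ioc]
    exact hφ.integrableOn_Ioc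

section
variable {Ω : Type*} [MeasurableSpace Ω] (μ : Measure Ω) [IsProbabilityMeasure μ]

lemma nw_fubini {𝕜 : Type*} [RCLike 𝕜] (F : Ω → 𝕜) (Y : Ω → ℝ) (hY : Measurable Y)
    (hF : AEStronglyMeasurable F μ) (hFY : Integrable (fun ω => Y ω • F ω) μ)
    (φ : ℝ → 𝕜) (hφ : Continuous φ) (C : ℝ) (hC : ∀ y, ‖φ y‖ ≤ C) :
    Integrable (fun y => φ y * ∫ ω, nwKer (Y ω) y • F ω ∂μ) ∧
    ∫ y, φ y * ∫ ω, nwKer (Y ω) y • F ω ∂μ = ∫ ω, F ω * (∫ y in (0:ℝ)..(Y ω), φ y) ∂μ := by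
  have hk : Measurable (fun p : Ω × ℝ => nwKer (Y p.1) p.2) :=
    nwKer_measurable.comp ((hY.comp measurable_fst).prodMk measurable_snd)
  have hint0 : Integrable (fun p : Ω × ℝ => |nwKer (Y p.1) p.2| * ‖F p.1‖) (μ.prod volume) := by
    rw [integrable_prod_iff]
    · constructor
      · exact ae_of_all _ fun ω => (nwKer_abs_integrable (Y ω)).mul_const ‖F ω‖
      · simp only [norm_mul, Real.norm_eq_abs, abs_abs, abs_norm, integral_mul_const,
          nwKer_abs_integral]
        simpa only [norm_smul, Real.norm_eq_abs] using hFY.norm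
    · exact (hk.abs.aestronglyMeasurable).mul hF.norm.comp_fst
  have hint : Integrable (fun p : Ω × ℝ => nwKer (Y p.1) p.2 • (F p.1 * φ p.2))
      (μ.prod volume) := by
    refine (hint0.const_mul C).mono' ?_ (ae_of_all _ fun p => ?_)
    · exact (hk.aestronglyMeasurable).smul
        (hF.comp_fst.mul (hφ.aestronglyMeasurable (μ := volume)).comp_snd)
    · rw [norm_smul, norm_mul, Real.norm_eq_abs]
      have := mul_le_mul_of_nonneg_left (hC p.2)
        (mul_nonneg (abs_nonneg (nwKer (Y p.1) p.2)) (norm_nonneg (F p.1)))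
      linarith
  have e1 : ∀ y, ∫ ω, nwKer (Y ω) y • (F ω * φ y) ∂μ = φ y * ∫ ω, nwKer (Y ω) y • F ω ∂μ := by
    intro y
    rw [← integral_const_mul]
    congr 1
    ext ω
    rw [mul_smul_comm, mul_comm]
  have e2 : ∀ ω, ∫ y, nwKer (Y ω) y • (F ω * φ y) = F ω * ∫ y in (0:ℝ)..(Y ω), φ y := by
    intro ω
    rw [← nwKer_integral _ _ hφ, ← integral_const_mul]
    congr 1
    ext y
    rw [mul_smul_comm]
  constructor
  · have := hint.integral_prod_right
    simpa only [e1] using this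
  · have := integral_integral_swap (f := fun ω y => nwKer (Y ω) y • (F ω * φ y)) hint
    simp only [e1, e2] at this
    exact this.symm

lemma nw_core (F : Ω → ℂ) (T Y : Ω → ℝ) (hF : Measurable F) (hF1 : ∀ ω, ‖F ω‖ ≤ 1)
    (hY : Measurable Y) (hT2 : MemLp T 2 μ) (hY2 : MemLp Y 2 μ)
    (H : ∀ y, ‖(∫ ω, nwKer (Y ω) y • F ω ∂μ) - (∫ ω, F ω ∂μ) * ∫ ω, nwKer (Y ω) y • (1:ℂ) ∂μ‖
      ≤ (∫ ω, nwKer (Y ω) y • T ω ∂μ) - (∫ ω, T ω ∂μ) * ∫ ω, nwKer (Y ω) y • (1:ℝ) ∂μ)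
    (t : ℝ) :
    ‖(∫ ω, F ω * Complex.exp (Complex.I * Complex.ofReal (t * Y ω)) ∂μ)
      - (∫ ω, F ω ∂μ) * ∫ ω, Complex.exp (Complex.I * Complex.ofReal (t * Y ω)) ∂μ‖
      ≤ |t| * cov μ T Y := by
  have hYi : Integrable Y μ := hY2.integrable (by norm_num)
  have hTi : Integrable T μ := hT2.integrable (by norm_num)
  have hTY : Integrable (fun ω => T ω * Y ω) μ := hT2.integrable_mul hY2
  have hFi : Integrable F μ :=
    (integrable_const (1:ℝ)).mono' hF.aestronglyMeasurable (ae_of_all _ hF1)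
  have hφ : Continuous (fun y : ℝ => Complex.I * t * Complex.exp (Complex.I * t * y)) := by
    fun_prop
  have hφn : ∀ y : ℝ, ‖Complex.I * t * Complex.exp (Complex.I * t * y)‖ = |t| := by
    intro y
    have h : Complex.I * t * y = ((t * y : ℝ) : ℂ) * Complex.I := by
      push_cast
      ring
    rw [h, norm_mul, Complex.norm_exp_ofReal_mul_I]
    simp
  have hΦ : ∀ a : ℝ, ∫ y in (0:ℝ)..a, Complex.I * t * Complex.exp (Complex.I * t * y)
      = Complex.exp (Complex.I * Complex.ofReal (t * a)) - 1 := by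
    intro a
    have hd : ∀ y ∈ Set.uIcc 0 a, HasDerivAt (fun y : ℝ => Complex.exp (Complex.I * t * y))
        (Complex.I * t * Complex.exp (Complex.I * t * y)) y := by
      intro y _
      have h1 : HasDerivAt (fun y : ℝ => Complex.I * t * (y:ℂ)) (Complex.I * t * 1) y :=
        (Complex.ofRealCLM.hasDerivAt (x := y)).const_mul (Complex.I * t)
      simpa [mul_comm] using h1.cexp
    rw [intervalIntegral.integral_eq_sub_of_hasDerivAt hd (hφ.intervalIntegrable _ _)]
    simp [mul_assoc]
  have hFY : Integrable (fun ω => Y ω • F ω) μ := by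
    refine hYi.norm.mono' (hY.aestronglyMeasurable.smul hF.aestronglyMeasurable)
      (ae_of_all _ fun ω => ?_)
    rw [norm_smul]
    exact mul_le_of_le_one_right (norm_nonneg _) (hF1 ω)
  obtain ⟨i1, j1⟩ := nw_fubini μ F Y hY hF.aestronglyMeasurable hFY _ hφ |t|
    (fun y => (hφn y).le)
  obtain ⟨i2, j2⟩ := nw_fubini μ (fun _ => (1:ℂ)) Y hY aestronglyMeasurable_const
    (hYi.smul_const _) _ hφ |t| (fun y => (hφn y).le)
  obtain ⟨i3, j3⟩ := nw_fubini μ T Y hY hT2.1 (by simpa [mul_comm] using hTY) (fun _ => |t|)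
    continuous_const |t| (fun y => by simp)
  obtain ⟨i4, j4⟩ := nw_fubini μ (fun _ => (1:ℝ)) Y hY aestronglyMeasurable_const
    (hYi.smul_const _) (fun _ => |t|) continuous_const |t| (fun y => by simp)
  simp only [hΦ] at j1 j2
  have hE : Measurable (fun ω => Complex.exp (Complex.I * Complex.ofReal (t * Y ω))) := by
    fun_prop
  have hE1 : ∀ ω, ‖Complex.exp (Complex.I * Complex.ofReal (t * Y ω))‖ ≤ 1 := by
    intro ω
    rw [mul_comm Complex.I, Complex.norm_exp_ofReal_mul_I]
  have hEi : Integrable (fun ω => Complex.exp (Complex.I * Complex.ofReal (t * Y ω))) μ :=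
    (integrable_const (1:ℝ)).mono' hE.aestronglyMeasurable (ae_of_all _ hE1)
  have hFE : Integrable (fun ω => F ω * Complex.exp (Complex.I * Complex.ofReal (t * Y ω))) μ := by
    refine (integrable_const (1:ℝ)).mono' (hF.mul hE).aestronglyMeasurable
      (ae_of_all _ fun ω => ?_)
    rw [norm_mul]
    exact mul_le_one₀ (hF1 ω) (norm_nonneg _) (hE1 ω)
  have L : (∫ ω, F ω * Complex.exp (Complex.I * Complex.ofReal (t * Y ω)) ∂μ)
      - (∫ ω, F ω ∂μ) * ∫ ω, Complex.exp (Complex.I * Complex.ofReal (t * Y ω)) ∂μ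
      = ∫ y : ℝ, Complex.I * t * Complex.exp (Complex.I * t * y) *
        ((∫ ω, nwKer (Y ω) y • F ω ∂μ) - (∫ ω, F ω ∂μ) * ∫ ω, nwKer (Y ω) y • (1:ℂ) ∂μ) := by
    have : ∀ y : ℝ, Complex.I * t * Complex.exp (Complex.I * t * y) *
        ((∫ ω, nwKer (Y ω) y • F ω ∂μ) - (∫ ω, F ω ∂μ) * ∫ ω, nwKer (Y ω) y • (1:ℂ) ∂μ)
        = Complex.I * t * Complex.exp (Complex.I * t * y) * (∫ ω, nwKer (Y ω) y • F ω ∂μ)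
        - (∫ ω, F ω ∂μ) * (Complex.I * t * Complex.exp (Complex.I * t * y) *
           ∫ ω, nwKer (Y ω) y • (1:ℂ) ∂μ) := fun y => by ring
    simp only [this]
    rw [integral_sub i1 (i2.const_mul _), integral_const_mul, j1, j2]
    simp only [mul_sub, mul_one, one_mul]
    rw [integral_sub hFE hFi, integral_sub hEi (integrable_const _)]
    simp
    ring
  have R3 : ∀ y : ℝ, |t| *
        ((∫ ω, nwKer (Y ω) y • T ω ∂μ) - (∫ ω, T ω ∂μ) * ∫ ω, nwKer (Y ω) y • (1:ℝ) ∂μ)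
        = |t| * (∫ ω, nwKer (Y ω) y • T ω ∂μ)
        - (∫ ω, T ω ∂μ) * (|t| * ∫ ω, nwKer (Y ω) y • (1:ℝ) ∂μ) := fun y => by ring
  have R : |t| * cov μ T Y = ∫ y : ℝ, |t| *
        ((∫ ω, nwKer (Y ω) y • T ω ∂μ) - (∫ ω, T ω ∂μ) * ∫ ω, nwKer (Y ω) y • (1:ℝ) ∂μ) := by
    simp only [R3]
    rw [integral_sub i3 (i4.const_mul _), integral_const_mul (∫ ω, T ω ∂μ), j3, j4]
    simp only [intervalIntegral.integral_const, sub_zero, smul_eq_mul, one_mul, ← mul_assoc,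
      integral_mul_const, cov]
    ring
  rw [L, R]
  refine norm_integral_le_of_norm_le ?_ (ae_of_all _ fun y => ?_)
  · simp only [R3]
    exact i3.sub (i4.const_mul _)
  · rw [norm_mul, hφn]
    exact mul_le_mul_of_nonneg_left (H y) (abs_nonneg _)

lemma nw_exp_lip (a b : ℝ) : ‖Complex.exp (Complex.I * Complex.ofReal a)
    - Complex.exp (Complex.I * Complex.ofReal b)‖ ≤ |a - b| := by
  have : Complex.exp (Complex.I * Complex.ofReal a) - Complex.exp (Complex.I * Complex.ofReal b)
    = Complex.exp (Complex.I * Complex.ofReal b) *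
      (Complex.exp (Complex.I * Complex.ofReal (a - b)) - 1) := by
    rw [mul_sub, ← Complex.exp_add, mul_one]
    congr 2
    push_cast
    ring
  rw [this, norm_mul, mul_comm Complex.I, Complex.norm_exp_ofReal_mul_I, one_mul]
  exact Real.norm_exp_I_mul_ofReal_sub_one_le

lemma nw_step (n : ℕ) (X : Fin n → Ω → ℝ) (hmeas : ∀ i, Measurable (X i))
    (hL2 : ∀ i, MemLp (X i) 2 μ) (hassoc : IsAssociated μ X) (t : Fin n → ℝ)
    (s : Finset (Fin n)) (a : Fin n) :
    ‖(∫ ω, Complex.exp (Complex.I * Complex.ofReal (∑ j ∈ s, t j * X j ω)) *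
          Complex.exp (Complex.I * Complex.ofReal (t a * X a ω)) ∂μ)
      - (∫ ω, Complex.exp (Complex.I * Complex.ofReal (∑ j ∈ s, t j * X j ω)) ∂μ) *
        ∫ ω, Complex.exp (Complex.I * Complex.ofReal (t a * X a ω)) ∂μ‖
      ≤ |t a| * cov μ (fun ω => ∑ j ∈ s, |t j| * X j ω) (X a) := by
  have hF : Measurable (fun ω => Complex.exp (Complex.I *
      Complex.ofReal (∑ j ∈ s, t j * X j ω))) := by fun_prop
  have hF1 : ∀ ω, ‖Complex.exp (Complex.I * Complex.ofReal (∑ j ∈ s, t j * X j ω))‖ ≤ 1 := by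
    intro ω
    rw [mul_comm Complex.I, Complex.norm_exp_ofReal_mul_I]
  have hT2 : MemLp (fun ω => ∑ j ∈ s, |t j| * X j ω) 2 μ :=
    memLp_finsetSum _ fun j _ => (hL2 j).const_mul _
  refine nw_core μ _ _ (X a) hF hF1 (hmeas a) hT2 (hL2 a) (fun y => ?_) (t a)
  set F : Ω → ℂ := fun ω => Complex.exp (Complex.I * Complex.ofReal (∑ j ∈ s, t j * X j ω))
    with hFdef
  set T : Ω → ℝ := fun ω => ∑ j ∈ s, |t j| * X j ω with hTdef
  have hTi : Integrable T μ := hT2.integrable (by norm_num)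
  have hFi : Integrable F μ :=
    (integrable_const (1:ℝ)).mono' hF.aestronglyMeasurable (ae_of_all _ hF1)
  have hkm : Measurable (fun ω => nwKer (X a ω) y) :=
    nwKer_measurable.comp ((hmeas a).prodMk measurable_const)
  have hkb : ∀ ω, ‖nwKer (X a ω) y‖ ≤ 1 := fun ω => nwKer_abs_le _ _
  have hki : Integrable (fun ω => nwKer (X a ω) y) μ :=
    (integrable_const (1:ℝ)).mono' hkm.aestronglyMeasurable (ae_of_all _ hkb)
  have hkF : Integrable (fun ω => nwKer (X a ω) y • F ω) μ :=
    hFi.bdd_smul 1 hkm.aestronglyMeasurable (ae_of_all _ hkb)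
  have hkT : Integrable (fun ω => nwKer (X a ω) y • T ω) μ :=
    hTi.bdd_smul 1 hkm.aestronglyMeasurable (ae_of_all _ hkb)
  set K : ℂ := (∫ ω, nwKer (X a ω) y • F ω ∂μ)
    - (∫ ω, F ω ∂μ) * ∫ ω, nwKer (X a ω) y • (1:ℂ) ∂μ with hK
  obtain ⟨c, hc1, hc⟩ : ∃ c : ℂ, ‖c‖ ≤ 1 ∧ c * K = ‖K‖ := by
    by_cases h : K = 0
    · exact ⟨0, by simp, by simp [h]⟩
    · refine ⟨‖K‖ / K, ?_, ?_⟩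
      · simp [h]
      · field_simp
  have hcFi : Integrable (fun ω => (c * F ω).re) μ := (hFi.const_mul c).re
  have hkcF : Integrable (fun ω => (c * F ω).re * nwKer (X a ω) y) μ := by
    refine (hcFi.bdd_smul 1 hkm.aestronglyMeasurable (ae_of_all _ hkb)).congr
      (ae_of_all _ fun ω => ?_)
    exact mul_comm _ _
  have hkT' : Integrable (fun ω => T ω * nwKer (X a ω) y) μ := by
    simpa [mul_comm] using hkT
  have key := hassoc
    (fun x => (∑ j ∈ s, |t j| * x j) -
      (c * Complex.exp (Complex.I * Complex.ofReal (∑ j ∈ s, t j * x j))).re)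
    (fun x => nwKer (x a) y) ?_ (fun x z h => nwKer_mono y (h a)) (hTi.sub hcFi) hki ?_
  · have hKre : ‖K‖ = (∫ ω, (c * F ω).re * nwKer (X a ω) y ∂μ)
        - (∫ ω, (c * F ω).re ∂μ) * ∫ ω, nwKer (X a ω) y ∂μ := by
      have h1 : (c * K).re = ‖K‖ := by rw [hc]; simp
      have h2 : ∫ ω, nwKer (X a ω) y • (1:ℂ) ∂μ = ((∫ ω, nwKer (X a ω) y ∂μ : ℝ) : ℂ) := by
        rw [← integral_complex_ofReal]
        simp
      have h3 : ∫ ω, (c * F ω).re ∂μ = (c * ∫ ω, F ω ∂μ).re := by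
        rw [← integral_const_mul]
        exact integral_re (hFi.const_mul c)
      have h4 : ∫ ω, (c * F ω).re * nwKer (X a ω) y ∂μ
          = (c * ∫ ω, nwKer (X a ω) y • F ω ∂μ).re := by
        rw [← integral_const_mul]
        refine Eq.trans ?_ (integral_re (hkF.const_mul c))
        congr 1
        ext ω
        simp
        ring
      rw [← h1, h3, h4, hK, h2, mul_sub, Complex.sub_re, ← mul_assoc, Complex.re_mul_ofReal]
    rw [hKre]
    have key2 : 0 ≤ (∫ ω, (T ω - (c * F ω).re) * nwKer (X a ω) y ∂μ)
        - (∫ ω, (T ω - (c * F ω).re) ∂μ) * ∫ ω, nwKer (X a ω) y ∂μ := key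
    simp only [sub_mul] at key2
    rw [integral_sub hkT' hkcF, integral_sub hTi hcFi] at key2
    have e1 : ∫ ω, nwKer (X a ω) y • T ω ∂μ = ∫ ω, T ω * nwKer (X a ω) y ∂μ := by
      congr 1
      ext ω
      exact mul_comm _ _
    rw [e1]
    simp only [smul_eq_mul, mul_one]
    linarith
  · intro x z h
    have h1 : (c * Complex.exp (Complex.I * Complex.ofReal (∑ j ∈ s, t j * z j))).re
      - (c * Complex.exp (Complex.I * Complex.ofReal (∑ j ∈ s, t j * x j))).re
      ≤ |(∑ j ∈ s, t j * z j) - ∑ j ∈ s, t j * x j| := by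
      rw [← Complex.sub_re, ← mul_sub]
      refine (Complex.re_le_norm _).trans ?_
      rw [norm_mul]
      exact (mul_le_of_le_one_left (norm_nonneg _) hc1).trans (nw_exp_lip _ _)
    have h2 : |(∑ j ∈ s, t j * z j) - ∑ j ∈ s, t j * x j|
        ≤ (∑ j ∈ s, |t j| * z j) - ∑ j ∈ s, |t j| * x j := by
      rw [← Finset.sum_sub_distrib, ← Finset.sum_sub_distrib]
      refine (Finset.abs_sum_le_sum_abs _ _).trans (Finset.sum_le_sum fun j _ => ?_)
      rw [← mul_sub, ← mul_sub, abs_mul, abs_of_nonneg (sub_nonneg.2 (h j))]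
    dsimp only
    linarith
  · have := hkT'.sub hkcF
    refine this.congr (ae_of_all _ fun ω => ?_)
    simp [hTdef, hFdef, sub_mul]

lemma nw_cov_sum (n : ℕ) (X : Fin n → Ω → ℝ)
    (hL2 : ∀ i, MemLp (X i) 2 μ) (t : Fin n → ℝ) (s : Finset (Fin n)) (a : Fin n) :
    |t a| * cov μ (fun ω => ∑ j ∈ s, |t j| * X j ω) (X a)
      = ∑ j ∈ s, |t j * t a| * cov μ (X j) (X a) := by
  unfold cov
  have h1 : ∀ j, Integrable (fun ω => |t j| * X j ω * X a ω) μ := by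
    intro j
    simpa only [mul_assoc, Pi.mul_apply] using ((hL2 j).integrable_mul (hL2 a)).const_mul |t j|
  have h2 : ∀ j, Integrable (fun ω => |t j| * X j ω) μ := fun j =>
    ((hL2 j).integrable (by norm_num)).const_mul _
  simp only [Finset.sum_mul]
  rw [integral_finsetSum _ fun j _ => h1 j, integral_finsetSum _ fun j _ => h2 j,
    Finset.sum_mul, ← Finset.sum_sub_distrib, Finset.mul_sum]
  refine Finset.sum_congr rfl fun j _ => ?_
  simp only [mul_assoc, integral_const_mul, abs_mul]
  ring

lemma nw_cov_comm (X Y : Ω → ℝ) : cov μ X Y = cov μ Y X := by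
  unfold cov
  rw [mul_comm (∫ ω, X ω ∂μ)]
  simp only [mul_comm (X _)]

lemma nw_finset (n : ℕ) (X : Fin n → Ω → ℝ) (hmeas : ∀ i, Measurable (X i))
    (hL2 : ∀ i, MemLp (X i) 2 μ) (hassoc : IsAssociated μ X) (t : Fin n → ℝ)
    (s : Finset (Fin n)) :
    ‖(∫ ω, Complex.exp (Complex.I * Complex.ofReal (∑ j ∈ s, t j * X j ω)) ∂μ)
        - ∏ j ∈ s, ∫ ω, Complex.exp (Complex.I * Complex.ofReal (t j * X j ω)) ∂μ‖
      ≤ (1 / 2) * ∑ p ∈ s.offDiag, |t p.1 * t p.2| * cov μ (X p.1) (X p.2) := by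
  induction s using Finset.induction_on with
  | empty => simp
  | insert a s ha ih =>
    have hstep := nw_step μ n X hmeas hL2 hassoc t s a
    rw [nw_cov_sum μ n X hL2] at hstep
    have hsum : ∑ p ∈ (insert a s).offDiag, |t p.1 * t p.2| * cov μ (X p.1) (X p.2)
        = ∑ p ∈ s.offDiag, |t p.1 * t p.2| * cov μ (X p.1) (X p.2)
          + 2 * ∑ j ∈ s, |t j * t a| * cov μ (X j) (X a) := by
      rw [Finset.offDiag_insert ha, Finset.sum_union, Finset.sum_union, Finset.sum_product,
        Finset.sum_product, Finset.sum_singleton]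
      · simp only [Finset.sum_singleton]
        have : ∀ j, |t a * t j| * cov μ (X a) (X j) = |t j * t a| * cov μ (X j) (X a) :=
          fun j => by rw [nw_cov_comm, mul_comm (t a)]
        simp only [this]
        ring
      · rw [Finset.disjoint_left]
        rintro ⟨x, y⟩
        simp only [Finset.mem_product, Finset.mem_singleton, Finset.mem_offDiag]
        grind
      · rw [Finset.disjoint_left]
        rintro ⟨x, y⟩
        simp only [Finset.mem_product, Finset.mem_singleton, Finset.mem_offDiag, Finset.mem_union]
        grind
    have hexp : ∀ ω, Complex.exp (Complex.I * Complex.ofReal (∑ j ∈ insert a s, t j * X j ω))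
        = Complex.exp (Complex.I * Complex.ofReal (∑ j ∈ s, t j * X j ω)) *
          Complex.exp (Complex.I * Complex.ofReal (t a * X a ω)) := by
      intro ω
      rw [Finset.sum_insert ha, ← Complex.exp_add]
      congr 1
      push_cast
      ring
    simp only [hexp]
    rw [hsum, Finset.prod_insert ha]
    have hn : ‖∫ ω, Complex.exp (Complex.I * Complex.ofReal (t a * X a ω)) ∂μ‖ ≤ 1 := by
      refine (norm_integral_le_integral_norm _).trans ?_
      simp only [mul_comm Complex.I, Complex.norm_exp_ofReal_mul_I]
      simp
    set A := ∫ ω, Complex.exp (Complex.I * Complex.ofReal (t a * X a ω)) ∂μ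
    set S := ∫ ω, Complex.exp (Complex.I * Complex.ofReal (∑ j ∈ s, t j * X j ω)) ∂μ
    set P := ∏ j ∈ s, ∫ ω, Complex.exp (Complex.I * Complex.ofReal (t j * X j ω)) ∂μ
    set J := ∫ ω, Complex.exp (Complex.I * Complex.ofReal (∑ j ∈ s, t j * X j ω)) *
          Complex.exp (Complex.I * Complex.ofReal (t a * X a ω)) ∂μ
    have : J - A * P = (J - S * A) + (S - P) * A := by ring
    rw [this]
    refine (norm_add_le _ _).trans ?_
    rw [norm_mul]
    have := mul_le_of_le_one_right (norm_nonneg (S - P)) hn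
    linarith

end

/-- **Newman–Wright inequality.** For associated random variables `X₁, …, Xₙ` with finite
variances, the joint characteristic function and the product of the marginal characteristic
functions differ by at most `(1/2) ∑_{i ≠ j} |tᵢ tⱼ| Cov(Xᵢ, Xⱼ)`. -/
theorem newman_wright_inequality
    {Ω : Type*} [MeasurableSpace Ω] (μ : Measure Ω) [IsProbabilityMeasure μ]
    (n : ℕ) (X : Fin n → Ω → ℝ)
    (hmeas : ∀ i, Measurable (X i))
    (hL2 : ∀ i, MemLp (X i) 2 μ)
    (hassoc : IsAssociated μ X)
    (t : Fin n → ℝ) :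
    ‖(∫ ω, Complex.exp (Complex.I * Complex.ofReal (∑ j, t j * X j ω)) ∂μ)
        - ∏ j, ∫ ω, Complex.exp (Complex.I * Complex.ofReal (t j * X j ω)) ∂μ‖
      ≤ (1 / 2) * ∑ p ∈ (Finset.univ : Finset (Fin n)).offDiag,
          |t p.1 * t p.2| * cov μ (X p.1) (X p.2) := by
  exact nw_finset μ n X hmeas hL2 hassoc t Finset.univ
end
end

section
/- Let X₁, X₂, … be an associated sequence of mean-zero, square-integrable real random variables, let n = mℓ + r with integers m ≥ 1, ℓ ≥ 1, 0 ≤ r < ℓ, set S_k = X₁ + ⋯ + X_k, s_n² = Var(S_n) > 0, and let B_j = S_{jℓ} − S_{(j−1)ℓ} for j = 1,…,m. Then for every t ∈ ℝ, | E exp(i t S_{mℓ}/s_n) − ∏_{j=1}^{m} E exp(i t B_j/s_n) | ≤ (t²/2)·[ 1 − (1/s_n²)·∑_{j=1}^{m} Var(B_j) − (1/s_n²)·Var(S_n − S_{mℓ}) ]. -/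
open MeasureTheory ProbabilityTheory Filter Topology

noncomputable section

/-- The kernel `1_{u ≤ x} - 1_{u ≤ 0}` used for Hoeffding's formula. -/
def hKer (u x : ℝ) : ℝ := (if u ≤ x then 1 else 0) - (if u ≤ 0 then 1 else 0)

lemma hKer_mono (u : ℝ) : Monotone (hKer u) := by
  intro x y hxy
  unfold hKer
  split_ifs <;> first | linarith | norm_num

lemma hKer_abs_le (u x : ℝ) : ‖hKer u x‖ ≤ 1 := by
  unfold hKer
  split_ifs <;> norm_num

lemma hKer_measurable {α : Type*} [MeasurableSpace α] {f g : α → ℝ}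
    (hf : Measurable f) (hg : Measurable g) : Measurable (fun x => hKer (f x) (g x)) := by
  unfold hKer
  exact (Measurable.ite (measurableSet_le hf hg) measurable_const measurable_const).sub
    (Measurable.ite (measurableSet_le hf measurable_const) measurable_const measurable_const)

lemma hKer_eq (x u : ℝ) : hKer u x
    = (Set.Ioc 0 x).indicator (fun _ => (1 : ℝ)) u - (Set.Ioc x 0).indicator (fun _ => 1) u := by
  unfold hKer
  simp only [Set.indicator, Set.mem_Ioc]
  split_ifs <;> grind

lemma hKer_integrable (x : ℝ) : Integrable (fun u => hKer u x) := by
  simp_rw [hKer_eq]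
  refine Integrable.sub ?_ ?_
  · exact (integrable_indicator_iff measurableSet_Ioc).2 (integrableOn_const (by simp))
  · exact (integrable_indicator_iff measurableSet_Ioc).2 (integrableOn_const (by simp))

lemma hKer_norm_integral (x : ℝ) : ∫ u, ‖hKer u x‖ = |x| := by
  have h : ∀ u, ‖hKer u x‖ = (Set.uIoc 0 x).indicator (fun _ => (1 : ℝ)) u := by
    intro u
    rw [hKer_eq]
    simp only [Set.indicator, Set.mem_Ioc, Set.mem_uIoc]
    split_ifs <;> first | (norm_num; done) | grind
  simp_rw [h]
  rw [integral_indicator measurableSet_uIoc]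
  simp [Measure.real]

lemma hKer_integral (a : ℝ → ℂ) (ha : Continuous a) (x : ℝ) :
    ∫ u, a u * (hKer u x : ℂ) = ∫ u in (0:ℝ)..x, a u := by
  have h : ∀ u, a u * (hKer u x : ℂ)
      = (Set.Ioc 0 x).indicator a u - (Set.Ioc x 0).indicator a u := by
    intro u
    rw [hKer_eq]
    simp only [Set.indicator]
    split_ifs <;> simp
  simp_rw [h]
  rw [integral_sub, integral_indicator measurableSet_Ioc, integral_indicator measurableSet_Ioc]
  · rfl
  · exact (integrable_indicator_iff measurableSet_Ioc).2 (ha.integrableOn_Ioc)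
  · exact (integrable_indicator_iff measurableSet_Ioc).2 (ha.integrableOn_Ioc)

section core
variable {Ω : Type*} [MeasurableSpace Ω] (μ : Measure Ω) [IsProbabilityMeasure μ]

lemma hKer_int1 (U : Ω → ℝ) (hU : Measurable U) (hUi : Integrable U μ) :
    Integrable (fun p : ℝ × Ω => hKer p.1 (U p.2)) (volume.prod μ) := by
  have hm : AEStronglyMeasurable (fun p : ℝ × Ω => hKer p.1 (U p.2)) (volume.prod μ) :=
    (hKer_measurable measurable_fst (hU.comp measurable_snd)).aestronglyMeasurable
  rw [integrable_prod_iff' hm]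
  refine ⟨ae_of_all _ fun ω => hKer_integrable (U ω), ?_⟩
  simp_rw [hKer_norm_integral]
  exact hUi.abs

lemma hKer_int2 (U V : Ω → ℝ) (hU : Measurable U) (hV : Measurable V)
    (hUV : Integrable (fun ω => U ω * V ω) μ) :
    Integrable (fun p : (ℝ × ℝ) × Ω => hKer p.1.1 (U p.2) * hKer p.1.2 (V p.2))
      ((volume.prod volume).prod μ) := by
  rw [integrable_prod_iff']
  · refine ⟨ae_of_all _ fun ω => (hKer_integrable (U ω)).mul_prod (hKer_integrable (V ω)), ?_⟩
    have : ∀ ω, ∫ p : ℝ × ℝ, ‖hKer p.1 (U ω) * hKer p.2 (V ω)‖ ∂(volume.prod volume)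
        = |U ω * V ω| := by
      intro ω
      simp_rw [norm_mul]
      rw [integral_prod_mul (fun u => ‖hKer u (U ω)‖) (fun u => ‖hKer u (V ω)‖),
        hKer_norm_integral, hKer_norm_integral, abs_mul]
    simp_rw [this]
    exact hUV.abs
  · exact ((hKer_measurable (measurable_fst.comp measurable_fst) (hU.comp measurable_snd)).mul
      (hKer_measurable (measurable_snd.comp measurable_fst)
        (hV.comp measurable_snd))).aestronglyMeasurable

lemma hoeffding_single (U : Ω → ℝ) (hU : Measurable U) (hUi : Integrable U μ)
    (a : ℝ → ℂ) (ha : Continuous a) (M : ℝ) (hM : ∀ u, ‖a u‖ ≤ M) :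
    Integrable (fun u => a u * ((∫ ω, hKer u (U ω) ∂μ : ℝ) : ℂ)) ∧
    ∫ ω, (∫ u in (0:ℝ)..(U ω), a u) ∂μ
      = ∫ u, a u * ((∫ ω, hKer u (U ω) ∂μ : ℝ) : ℂ) := by
  have hi : Integrable (fun p : ℝ × Ω => a p.1 * (hKer p.1 (U p.2) : ℂ)) (volume.prod μ) :=
    (hKer_int1 μ U hU hUi).ofReal.bdd_mul (c := M)
      (ha.measurable.comp measurable_fst).aestronglyMeasurable (ae_of_all _ fun p => hM _)
  have e : ∀ u, ∫ ω, a u * (hKer u (U ω) : ℂ) ∂μ = a u * ((∫ ω, hKer u (U ω) ∂μ : ℝ) : ℂ) := by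
    intro u
    rw [integral_const_mul, integral_complex_ofReal]
  constructor
  · simp_rw [← e]
    exact hi.integral_prod_left
  · simp_rw [← hKer_integral a ha, ← e]
    exact (integral_integral_swap (f := fun u ω => a u * (hKer u (U ω) : ℂ)) hi).symm

lemma hoeffding_double (U V : Ω → ℝ) (hU : Measurable U) (hV : Measurable V)
    (hUV : Integrable (fun ω => U ω * V ω) μ)
    (a : ℝ → ℂ) (ha : Continuous a) (M : ℝ) (hM : ∀ u, ‖a u‖ ≤ M) :
    Integrable (fun p : ℝ × ℝ => a p.1 * a p.2 *
      ((∫ ω, hKer p.1 (U ω) * hKer p.2 (V ω) ∂μ : ℝ) : ℂ)) (volume.prod volume) ∧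
    ∫ ω, (∫ u in (0:ℝ)..(U ω), a u) * (∫ u in (0:ℝ)..(V ω), a u) ∂μ
      = ∫ p : ℝ × ℝ, a p.1 * a p.2 *
        ((∫ ω, hKer p.1 (U ω) * hKer p.2 (V ω) ∂μ : ℝ) : ℂ) ∂(volume.prod volume) := by
  have hi : Integrable (fun p : (ℝ × ℝ) × Ω => a p.1.1 * a p.1.2 *
      ((hKer p.1.1 (U p.2) * hKer p.1.2 (V p.2) : ℝ) : ℂ)) ((volume.prod volume).prod μ) := by
    refine (hKer_int2 μ U V hU hV hUV).ofReal.bdd_mul (c := M * M) ?_ (ae_of_all _ fun p => ?_)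
    · exact ((ha.measurable.comp (measurable_fst.comp measurable_fst)).mul
        (ha.measurable.comp (measurable_snd.comp measurable_fst))).aestronglyMeasurable
    · rw [norm_mul]
      exact mul_le_mul (hM _) (hM _) (norm_nonneg _) ((norm_nonneg _).trans (hM 0))
  have e : ∀ p : ℝ × ℝ, ∫ ω, a p.1 * a p.2 * ((hKer p.1 (U ω) * hKer p.2 (V ω) : ℝ) : ℂ) ∂μ
      = a p.1 * a p.2 * ((∫ ω, hKer p.1 (U ω) * hKer p.2 (V ω) ∂μ : ℝ) : ℂ) := by
    intro p
    rw [integral_const_mul, integral_complex_ofReal]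
  constructor
  · simp_rw [← e]
    exact hi.integral_prod_left
  · simp_rw [← hKer_integral a ha, ← e]
    rw [integral_integral_swap
      (f := fun (p : ℝ × ℝ) ω => a p.1 * a p.2 * ((hKer p.1 (U ω) * hKer p.2 (V ω) : ℝ) : ℂ)) hi]
    congr 1
    ext ω
    rw [← integral_prod_mul (fun u => a u * (hKer u (U ω) : ℂ)) (fun u => a u * (hKer u (V ω) : ℂ))]
    congr 1
    ext p
    push_cast
    ring

lemma hoeffding_cov (U V : Ω → ℝ) (hU : Measurable U) (hV : Measurable V)
    (hUi : Integrable U μ) (hVi : Integrable V μ)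
    (hUV : Integrable (fun ω => U ω * V ω) μ)
    (a : ℝ → ℂ) (ha : Continuous a) (M : ℝ) (hM : ∀ u, ‖a u‖ ≤ M) :
    Integrable (fun p : ℝ × ℝ => a p.1 * a p.2 *
      ((cov μ (fun ω => hKer p.1 (U ω)) (fun ω => hKer p.2 (V ω)) : ℝ) : ℂ))
        (volume.prod volume) ∧
    ∫ ω, (∫ u in (0:ℝ)..(U ω), a u) * (∫ u in (0:ℝ)..(V ω), a u) ∂μ
      - (∫ ω, (∫ u in (0:ℝ)..(U ω), a u) ∂μ) * (∫ ω, (∫ u in (0:ℝ)..(V ω), a u) ∂μ)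
      = ∫ p : ℝ × ℝ, a p.1 * a p.2 *
        ((cov μ (fun ω => hKer p.1 (U ω)) (fun ω => hKer p.2 (V ω)) : ℝ) : ℂ)
          ∂(volume.prod volume) := by
  obtain ⟨h1, h2⟩ := hoeffding_double μ U V hU hV hUV a ha M hM
  obtain ⟨h3, h4⟩ := hoeffding_single μ U hU hUi a ha M hM
  obtain ⟨h5, h6⟩ := hoeffding_single μ V hV hVi a ha M hM
  have h7 := h3.mul_prod h5
  have e : ∀ p : ℝ × ℝ, a p.1 * a p.2 *
      ((cov μ (fun ω => hKer p.1 (U ω)) (fun ω => hKer p.2 (V ω)) : ℝ) : ℂ)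
      = a p.1 * a p.2 * ((∫ ω, hKer p.1 (U ω) * hKer p.2 (V ω) ∂μ : ℝ) : ℂ)
        - (a p.1 * ((∫ ω, hKer p.1 (U ω) ∂μ : ℝ) : ℂ))
          * (a p.2 * ((∫ ω, hKer p.2 (V ω) ∂μ : ℝ) : ℂ)) := by
    intro p
    unfold cov
    push_cast
    ring
  simp_rw [e]
  refine ⟨h1.sub h7, ?_⟩
  rw [integral_sub h1 h7, h2, h4, h6, integral_prod_mul
    (fun u => a u * ((∫ ω, hKer u (U ω) ∂μ : ℝ) : ℂ))
    (fun u => a u * ((∫ ω, hKer u (V ω) ∂μ : ℝ) : ℂ))]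

lemma exp_int (c x : ℝ) : ∫ u in (0:ℝ)..x, Complex.I * c * Complex.exp (Complex.I * c * u)
    = Complex.exp (Complex.I * c * x) - 1 := by
  have := intervalIntegral.integral_eq_sub_of_hasDerivAt (a := 0) (b := x)
    (f := fun u : ℝ => Complex.exp (Complex.I * c * u))
    (f' := fun u : ℝ => Complex.I * c * Complex.exp (Complex.I * c * u)) ?_ ?_
  · rw [this]; simp
  · intro u _
    have h1 : HasDerivAt (fun u : ℝ => Complex.I * c * (u : ℂ)) (Complex.I * c * 1) u :=
      (Complex.ofRealCLM.hasDerivAt (x := u)).const_mul _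
    have := h1.cexp
    convert! this using 1
    ring
  · apply Continuous.intervalIntegrable
    fun_prop

lemma exp_norm (c u : ℝ) : ‖Complex.exp (Complex.I * c * u)‖ = 1 := by
  rw [show Complex.I * c * u = ((c * u : ℝ) : ℂ) * Complex.I by push_cast; ring]
  exact Complex.norm_exp_ofReal_mul_I _

lemma exp_integrable (c : ℝ) (U : Ω → ℝ) (hU : Measurable U) :
    Integrable (fun ω => Complex.exp (Complex.I * c * U ω)) μ := by
  refine Integrable.of_bound (C := 1) (Measurable.aestronglyMeasurable (by fun_prop))
    (ae_of_all _ fun ω => ?_)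
  rw [exp_norm]

lemma newman_pair (U V : Ω → ℝ) (hU : Measurable U) (hV : Measurable V)
    (hU2 : MemLp U 2 μ) (hV2 : MemLp V 2 μ)
    (hC : ∀ u v, 0 ≤ cov μ (fun ω => hKer u (U ω)) (fun ω => hKer v (V ω))) (c : ℝ) :
    ‖∫ ω, Complex.exp (Complex.I * c * (U ω + V ω : ℝ)) ∂μ
      - (∫ ω, Complex.exp (Complex.I * c * U ω) ∂μ) *
        ∫ ω, Complex.exp (Complex.I * c * V ω) ∂μ‖ ≤ c ^ 2 * cov μ U V := by
  have hUi : Integrable U μ := hU2.integrable (by norm_num)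
  have hVi : Integrable V μ := hV2.integrable (by norm_num)
  have hUV : Integrable (fun ω => U ω * V ω) μ := hU2.integrable_mul hV2
  obtain ⟨i1, e1⟩ := hoeffding_cov μ U V hU hV hUi hVi hUV (fun _ => 1) continuous_const 1
    (by simp)
  obtain ⟨i2, e2⟩ := hoeffding_cov μ U V hU hV hUi hVi hUV
    (fun u => Complex.I * c * Complex.exp (Complex.I * c * u)) (by fun_prop) |c|
    (by intro u; rw [norm_mul, exp_norm]; simp)
  simp only [exp_int] at e2
  have iU := exp_integrable μ c U hU
  have iV := exp_integrable μ c V hV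
  have iS := exp_integrable μ c (fun ω => U ω + V ω) (hU.add hV)
  have key : ∫ ω, Complex.exp (Complex.I * c * (U ω + V ω : ℝ)) ∂μ
      - (∫ ω, Complex.exp (Complex.I * c * U ω) ∂μ) *
        ∫ ω, Complex.exp (Complex.I * c * V ω) ∂μ
      = ∫ ω, (Complex.exp (Complex.I * c * U ω) - 1) * (Complex.exp (Complex.I * c * V ω) - 1) ∂μ
        - (∫ ω, (Complex.exp (Complex.I * c * U ω) - 1) ∂μ) *
          ∫ ω, (Complex.exp (Complex.I * c * V ω) - 1) ∂μ := by
    have : ∀ ω, (Complex.exp (Complex.I * c * U ω) - 1) * (Complex.exp (Complex.I * c * V ω) - 1)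
        = Complex.exp (Complex.I * c * (U ω + V ω : ℝ)) - Complex.exp (Complex.I * c * U ω)
          - Complex.exp (Complex.I * c * V ω) + 1 := by
      intro ω
      push_cast
      rw [mul_add, Complex.exp_add]
      ring
    simp_rw [this]
    have iD : Integrable (fun ω => Complex.exp (Complex.I * c * (U ω + V ω : ℝ))
        - Complex.exp (Complex.I * c * U ω)) μ := iS.sub iU
    have iE : Integrable (fun ω => Complex.exp (Complex.I * c * (U ω + V ω : ℝ))
        - Complex.exp (Complex.I * c * U ω) - Complex.exp (Complex.I * c * V ω)) μ := iD.sub iV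
    rw [integral_add iE (integrable_const _), integral_sub iD iV,
      integral_sub iS iU, integral_sub iU (integrable_const _),
      integral_sub iV (integrable_const _)]
    simp only [integral_const, probReal_univ, one_smul]
    ring
  rw [key, e2]
  have hcov : cov μ U V = ∫ p : ℝ × ℝ,
      cov μ (fun ω => hKer p.1 (U ω)) (fun ω => hKer p.2 (V ω)) ∂(volume.prod volume) := by
    have e3 : ((cov μ U V : ℝ) : ℂ) = ((∫ p : ℝ × ℝ,
      cov μ (fun ω => hKer p.1 (U ω)) (fun ω => hKer p.2 (V ω)) ∂(volume.prod volume) : ℝ) : ℂ) := by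
      rw [← integral_complex_ofReal]
      simp only [one_mul] at e1
      rw [← e1]
      unfold cov
      push_cast
      simp only [← integral_complex_ofReal]
      simp
    exact_mod_cast e3
  rw [hcov, ← integral_const_mul]
  refine (norm_integral_le_integral_norm _).trans (le_of_eq ?_)
  congr 1
  ext p
  simp only [norm_mul, exp_norm, Complex.norm_I, Complex.norm_real, Real.norm_eq_abs]
  rw [abs_of_nonneg (hC _ _), one_mul, mul_one, ← pow_two, sq_abs]

lemma cov_eq_covariance (U V : Ω → ℝ) (hU2 : MemLp U 2 μ) (hV2 : MemLp V 2 μ) :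
    cov μ U V = covariance U V μ := by
  rw [covariance_eq_sub hU2 hV2]
  rfl

lemma cov_part_nonneg (X : ℕ → Ω → ℝ) (hassoc : IsAssociatedSeq μ X) (i j : ℕ)
    (f g : ℝ → ℝ) (hf : Monotone f) (hg : Monotone g)
    (h1 : Integrable (fun ω => f (∑ a ∈ Finset.range i, X a ω)) μ)
    (h2 : Integrable (fun ω => g (∑ a ∈ Finset.Ico i j, X a ω)) μ)
    (h3 : Integrable (fun ω => f (∑ a ∈ Finset.range i, X a ω) *
      g (∑ a ∈ Finset.Ico i j, X a ω)) μ) (hij : i ≤ j) :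
    0 ≤ cov μ (fun ω => f (∑ a ∈ Finset.range i, X a ω))
      (fun ω => g (∑ a ∈ Finset.Ico i j, X a ω)) := by
  have e1 : ∀ ω, ∑ a ∈ Finset.range i, X a ω = ∑ a : Fin j, if a.1 < i then X a ω else 0 := by
    intro ω
    rw [Fin.sum_univ_eq_sum_range (fun a => if a < i then X a ω else 0) j, ← Finset.sum_filter]
    congr 1
    ext a
    simp
    omega
  have e2 : ∀ ω, ∑ a ∈ Finset.Ico i j, X a ω = ∑ a : Fin j, if i ≤ a.1 then X a ω else 0 := by
    intro ω
    rw [Fin.sum_univ_eq_sum_range (fun a => if i ≤ a then X a ω else 0) j, ← Finset.sum_filter]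
    congr 1
    ext a
    simp
    omega
  simp_rw [e1, e2] at *
  refine hassoc j (fun a => a.1) (fun x => f (∑ a : Fin j, if a.1 < i then x a else 0))
    (fun x => g (∑ a : Fin j, if i ≤ a.1 then x a else 0)) ?_ ?_ h1 h2 h3
  · intro x y hxy
    refine hf (Finset.sum_le_sum fun a _ => ?_)
    split_ifs
    · exact hxy a
    · exact le_rfl
  · intro x y hxy
    refine hg (Finset.sum_le_sum fun a _ => ?_)
    split_ifs
    · exact hxy a
    · exact le_rfl

end core

/-- **Block characteristic-function factorization bound (Newman's inequality applied to
blocks).** For an associated centered sequence with `n = mℓ + r`, `0 ≤ r < ℓ`, and blocks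
`B_j = S_{jℓ} − S_{(j−1)ℓ}`,
`|E e^{itS_{mℓ}/sₙ} − ∏ⱼ E e^{itBⱼ/sₙ}| ≤ (t²/2)(1 − (1/sₙ²)∑ⱼVar(Bⱼ) − (1/sₙ²)Var(Sₙ − S_{mℓ}))`. -/
theorem block_charFun_factorization_bound
    {Ω : Type*} [MeasurableSpace Ω] (μ : Measure Ω) [IsProbabilityMeasure μ]
    (X : ℕ → Ω → ℝ)
    (hmeas : ∀ i, Measurable (X i))
    (hL2 : ∀ i, MemLp (X i) 2 μ)
    (hmean : ∀ i, ∫ ω, X i ω ∂μ = 0)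
    (hassoc : IsAssociatedSeq μ X)
    (n m ℓ r : ℕ)
    (hm1 : 1 ≤ m) (hℓ1 : 1 ≤ ℓ) (hr : r < ℓ)
    (hdecomp : n = m * ℓ + r)
    (S : ℕ → Ω → ℝ)
    (hS : ∀ i ω, S i ω = ∑ a ∈ Finset.range i, X a ω)
    (hspos : 0 < variance (S n) μ)
    (B : ℕ → Ω → ℝ)
    (hB : ∀ j ω, B j ω = S (j * ℓ) ω - S ((j - 1) * ℓ) ω)
    (t : ℝ) :
    ‖(∫ ω, Complex.exp (Complex.I *
          Complex.ofReal (t * S (m * ℓ) ω / Real.sqrt (variance (S n) μ))) ∂μ)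
        - ∏ j ∈ Finset.Icc 1 m,
          ∫ ω, Complex.exp (Complex.I *
            Complex.ofReal (t * B j ω / Real.sqrt (variance (S n) μ))) ∂μ‖
      ≤ (t ^ 2 / 2) *
        (1 - (∑ j ∈ Finset.Icc 1 m, variance (B j) μ) / variance (S n) μ
          - variance (fun ω => S n ω - S (m * ℓ) ω) μ / variance (S n) μ) := by
  have hSm : ∀ i, Measurable (S i) := by
    intro i
    rw [show S i = fun ω => ∑ a ∈ Finset.range i, X a ω from funext (hS i)]
    exact Finset.measurable_sum _ fun a _ => hmeas a
  have hS2 : ∀ i, MemLp (S i) 2 μ := by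
    intro i
    rw [show S i = fun ω => ∑ a ∈ Finset.range i, X a ω from funext (hS i)]
    exact memLp_finsetSum _ fun a _ => hL2 a
  -- increments
  have hDm : ∀ i j, Measurable (fun ω => S j ω - S i ω) := fun i j => (hSm j).sub (hSm i)
  have hD2 : ∀ i j, MemLp (fun ω => S j ω - S i ω) 2 μ := fun i j => (hS2 j).sub (hS2 i)
  have hpos : ∀ i j, i ≤ j → ∀ f g : ℝ → ℝ, Monotone f → Monotone g →
      Integrable (fun ω => f (S i ω)) μ → Integrable (fun ω => g (S j ω - S i ω)) μ →
      Integrable (fun ω => f (S i ω) * g (S j ω - S i ω)) μ →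
      0 ≤ cov μ (fun ω => f (S i ω)) (fun ω => g (S j ω - S i ω)) := by
    intro i j hij f g hf hg
    have e : ∀ ω, S j ω - S i ω = ∑ a ∈ Finset.Ico i j, X a ω := by
      intro ω
      rw [hS, hS, Finset.sum_Ico_eq_sub _ hij]
    simp_rw [e, hS]
    intro h1 h2 h3
    exact cov_part_nonneg μ X hassoc i j f g hf hg h1 h2 h3 hij
  have hker : ∀ i j, i ≤ j → ∀ u v,
      0 ≤ cov μ (fun ω => hKer u (S i ω)) (fun ω => hKer v (S j ω - S i ω)) := by
    intro i j hij u v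
    have m1 := hKer_measurable (measurable_const (a := u)) (hSm i)
    have m2 := hKer_measurable (measurable_const (a := v)) (hDm i j)
    refine hpos i j hij _ _ (hKer_mono u) (hKer_mono v) ?_ ?_ ?_
    · exact Integrable.of_bound (C := 1) m1.aestronglyMeasurable
        (ae_of_all _ fun ω => hKer_abs_le _ _)
    · exact Integrable.of_bound (C := 1) m2.aestronglyMeasurable
        (ae_of_all _ fun ω => hKer_abs_le _ _)
    · refine Integrable.of_bound (C := 1) (m1.mul m2).aestronglyMeasurable
        (ae_of_all _ fun ω => ?_)
      rw [norm_mul]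
      exact mul_le_one₀ (hKer_abs_le _ _) (norm_nonneg _) (hKer_abs_le _ _)
  have hvar : ∀ i j, variance (S j) μ = variance (S i) μ +
      variance (fun ω => S j ω - S i ω) μ + 2 * cov μ (S i) (fun ω => S j ω - S i ω) := by
    intro i j
    rw [cov_eq_covariance μ _ _ (hS2 i) (hD2 i j)]
    have := variance_add (hS2 i) (hD2 i j)
    rw [show S i + (fun ω => S j ω - S i ω) = S j by ext ω; simp] at this
    rw [this]
    ring
  set s := Real.sqrt (variance (S n) μ) with hs
  have hs2 : s ^ 2 = variance (S n) μ := Real.sq_sqrt hspos.le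
  set c := t / s with hc
  have hexp : ∀ (Y : Ω → ℝ), ∫ ω, Complex.exp (Complex.I * Complex.ofReal (t * Y ω / s)) ∂μ
      = ∫ ω, Complex.exp (Complex.I * c * Y ω) ∂μ := by
    intro Y
    congr 1
    ext ω
    rw [hc]
    push_cast
    congr 1
    ring
  simp_rw [hexp]
  have main : ∀ k, ‖(∫ ω, Complex.exp (Complex.I * c * S (k * ℓ) ω) ∂μ)
      - ∏ j ∈ Finset.Icc 1 k, ∫ ω, Complex.exp (Complex.I * c * B j ω) ∂μ‖
      ≤ c ^ 2 / 2 * (variance (S (k * ℓ)) μ - ∑ j ∈ Finset.Icc 1 k, variance (B j) μ) := by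
    intro k
    induction k with
    | zero =>
      have h0 : S 0 = fun _ => 0 := by ext ω; simp [hS]
      have h1 : variance (fun _ : Ω => (0 : ℝ)) μ = 0 := variance_zero μ
      simp [h0, h1]
    | succ k ih =>
      have hBk : B (k + 1) = fun ω => S ((k + 1) * ℓ) ω - S (k * ℓ) ω := by
        ext ω
        rw [hB]
        simp
      have hle : k * ℓ ≤ (k + 1) * ℓ := Nat.mul_le_mul_right _ (Nat.le_succ k)
      rw [Finset.prod_Icc_succ_top (by omega), Finset.sum_Icc_succ_top (by omega)]
      have hp := newman_pair μ _ _ (hSm (k * ℓ)) (hDm (k * ℓ) ((k + 1) * ℓ)) (hS2 _) (hD2 _ _)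
        (hker _ _ hle) c
      have hv := hvar (k * ℓ) ((k + 1) * ℓ)
      rw [← hBk] at hv hp
      have hb : ∀ ω, S (k * ℓ) ω + (S ((k + 1) * ℓ) ω - S (k * ℓ) ω) = S ((k + 1) * ℓ) ω := by
        intro ω; ring
      simp_rw [hb] at hp
      have hBe : ∀ ω, S ((k + 1) * ℓ) ω - S (k * ℓ) ω = B (k + 1) ω := by
        intro ω; rw [hBk]
      simp_rw [hBe] at hp
      have hn : ‖∫ ω, Complex.exp (Complex.I * c * B (k + 1) ω) ∂μ‖ ≤ 1 := by
        have := norm_integral_le_of_norm_le_const (μ := μ) (C := 1)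
          (f := fun ω => Complex.exp (Complex.I * c * B (k + 1) ω))
          (ae_of_all _ fun ω => (exp_norm _ _).le)
        simpa using this
      set P := ∏ j ∈ Finset.Icc 1 k, ∫ ω, Complex.exp (Complex.I * c * B j ω) ∂μ
      set b := ∫ ω, Complex.exp (Complex.I * c * B (k + 1) ω) ∂μ
      set x := ∫ ω, Complex.exp (Complex.I * c * S (k * ℓ) ω) ∂μ
      set y := ∫ ω, Complex.exp (Complex.I * c * S ((k + 1) * ℓ) ω) ∂μ
      have h1 : ‖y - P * b‖ ≤ ‖y - x * b‖ + ‖x - P‖ * 1 := by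
        calc ‖y - P * b‖ = ‖(y - x * b) + (x - P) * b‖ := by congr 1; ring
          _ ≤ ‖y - x * b‖ + ‖(x - P) * b‖ := norm_add_le _ _
          _ ≤ _ := by
            rw [norm_mul]
            gcongr
      rw [hv]
      linarith
  have hR : 0 ≤ cov μ (S (m * ℓ)) (fun ω => S n ω - S (m * ℓ) ω) := by
    refine hpos (m * ℓ) n (by omega) id id monotone_id monotone_id ?_ ?_ ?_
    · exact (hS2 _).integrable (by norm_num)
    · exact (hD2 _ _).integrable (by norm_num)
    · exact (hS2 _).integrable_mul (hD2 _ _)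
  have hv := hvar (m * ℓ) n
  refine (main m).trans ?_
  have hc2 : c ^ 2 = t ^ 2 / variance (S n) μ := by rw [hc, div_pow, hs2]
  have hfin : t ^ 2 / 2 *
        (1 - (∑ j ∈ Finset.Icc 1 m, variance (B j) μ) / variance (S n) μ
          - variance (fun ω => S n ω - S (m * ℓ) ω) μ / variance (S n) μ)
      = c ^ 2 / 2 * (variance (S n) μ - (∑ j ∈ Finset.Icc 1 m, variance (B j) μ)
          - variance (fun ω => S n ω - S (m * ℓ) ω) μ) := by
    rw [hc2]
    field_simp
  rw [hfin]
  refine mul_le_mul_of_nonneg_left ?_ (by positivity)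
  linarith
end
end

section
/- Let X₁, X₂, … be an associated sequence of mean-zero, square-integrable real random variables with inf_{n≥1} s_n²/n > 0, and suppose u(1) < ∞ and u(r) → 0 as r → ∞, where u(r) = sup_{j≥1} ∑_{i : |i−j| ≥ r} Cov(X_i, X_j). Let ℓ(n) ≥ 1 be integers with ℓ(n) → ∞ and ℓ(n)/n → 0, put m(n) = ⌊n/ℓ(n)⌋, and let B_{j,n} = S_{jℓ(n)} − S_{(j−1)ℓ(n)} for j = 1,…,m(n). Then (1/s_n²)·[ Var(S_n) − ∑_{j=1}^{m(n)} Var(B_{j,n}) − Var(S_n − S_{m(n)ℓ(n)}) ] → 0 as n → ∞; equivalently, (1/s_n²)·∑_{j=1}^{m(n)} Var(B_{j,n}) + (1/s_n²)·Var(S_n − S_{m(n)ℓ(n)}) → 1. -/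
open MeasureTheory ProbabilityTheory Filter Topology

noncomputable section

lemma cov_nonneg_aux {Ω : Type*} [MeasurableSpace Ω] (μ : Measure Ω) [IsProbabilityMeasure μ]
    (X : ℕ → Ω → ℝ) (hL2 : ∀ i, MemLp (X i) 2 μ) (hassoc : IsAssociatedSeq μ X) (i j : ℕ) :
    0 ≤ cov μ (X i) (X j) := by
  have h := hassoc 2 ![i, j] (fun x => x 0) (fun x => x 1) (fun x y h => h 0) (fun x y h => h 1)
  simp only [Matrix.cons_val_zero, Matrix.cons_val_one] at h
  exact h ((hL2 i).integrable (by norm_num)) ((hL2 j).integrable (by norm_num))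
    ((hL2 i).integrable_mul (hL2 j))

lemma var_sum_aux {Ω : Type*} [MeasurableSpace Ω] (μ : Measure Ω) [IsProbabilityMeasure μ]
    (X : ℕ → Ω → ℝ) (hL2 : ∀ i, MemLp (X i) 2 μ) (A : Finset ℕ) :
    variance (fun ω => ∑ i ∈ A, X i ω) μ = ∑ i ∈ A, ∑ j ∈ A, cov μ (X i) (X j) := by
  rw [variance_fun_sum' (fun i _ => hL2 i)]
  refine Finset.sum_congr rfl fun i _ => Finset.sum_congr rfl fun j _ => ?_
  rw [covariance_eq_sub (hL2 i) (hL2 j)]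
  rfl

lemma block_decomp_aux (c : ℕ → ℕ → ℝ) (n l : ℕ) (hl : 1 ≤ l) :
    (∑ j ∈ Finset.range n, ∑ i ∈ Finset.range n, c j i)
      - (∑ k ∈ Finset.Icc 1 (n / l), ∑ j ∈ Finset.Ico ((k - 1) * l) (k * l),
          ∑ i ∈ Finset.Ico ((k - 1) * l) (k * l), c j i)
      - (∑ j ∈ Finset.Ico (n / l * l) n, ∑ i ∈ Finset.Ico (n / l * l) n, c j i)
    = ∑ j ∈ Finset.range n, ∑ i ∈ Finset.range n, if i / l = j / l then 0 else c j i := by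
  have h1 : (∑ k ∈ Finset.Icc 1 (n / l), ∑ j ∈ Finset.Ico ((k - 1) * l) (k * l),
          ∑ i ∈ Finset.Ico ((k - 1) * l) (k * l), c j i)
      + (∑ j ∈ Finset.Ico (n / l * l) n, ∑ i ∈ Finset.Ico (n / l * l) n, c j i)
      = ∑ j ∈ Finset.range n, ∑ i ∈ Finset.range n, if i / l = j / l then c j i else 0 := by
    have h2 : ∀ j ∈ Finset.range n, j / l ∈ Finset.range (n / l + 1) := by
      intro j hj
      rw [Finset.mem_range] at *
      exact Nat.lt_succ_of_le (Nat.div_le_div_right hj.le)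
    have h4 : ∀ k, (∑ j ∈ Finset.range n with j / l = k, ∑ i ∈ Finset.range n,
          if i / l = j / l then c j i else 0)
        = ∑ j ∈ Finset.range n with j / l = k, ∑ i ∈ Finset.range n with i / l = k, c j i := by
      intro k
      refine Finset.sum_congr rfl fun j hj => ?_
      rw [Finset.mem_filter] at hj
      rw [Finset.sum_filter, hj.2]
    have h5 : ∀ k ∈ Finset.range (n / l), (Finset.range n).filter (fun i => i / l = k)
        = Finset.Ico (k * l) ((k + 1) * l) := by
      intro k hk
      rw [Finset.mem_range] at hk
      have : (k + 1) * l ≤ n := (Nat.le_div_iff_mul_le hl).1 hk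
      ext i
      rw [Finset.mem_filter, Finset.mem_range, Finset.mem_Ico, Nat.div_eq_iff hl]
      have : (k + 1) * l = k * l + l := by ring
      omega
    have h6 : (Finset.range n).filter (fun i => i / l = n / l) = Finset.Ico (n / l * l) n := by
      ext i
      rw [Finset.mem_filter, Finset.mem_range, Finset.mem_Ico, Nat.div_eq_iff hl]
      have := Nat.lt_div_mul_add (a := n) hl
      omega
    rw [← Finset.sum_fiberwise_of_maps_to h2, Finset.sum_range_succ]
    congr 1
    · symm
      refine Finset.sum_bij (fun k _ => k + 1) ?_ ?_ ?_ ?_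
      · intro k hk
        rw [Finset.mem_range] at hk
        rw [Finset.mem_Icc]
        omega
      · intro a _ b _ h
        exact Nat.succ_injective h
      · intro b hb
        rw [Finset.mem_Icc] at hb
        exact ⟨b - 1, by rw [Finset.mem_range]; omega, by omega⟩
      · intro k hk
        rw [h4, h5 k hk, Nat.add_sub_cancel]
    · rw [h4, h6]
  have h3 : (∑ j ∈ Finset.range n, ∑ i ∈ Finset.range n, c j i)
      = (∑ j ∈ Finset.range n, ∑ i ∈ Finset.range n, if i / l = j / l then c j i else 0)
      + ∑ j ∈ Finset.range n, ∑ i ∈ Finset.range n, if i / l = j / l then 0 else c j i := by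
    simp only [← Finset.sum_add_distrib]
    refine Finset.sum_congr rfl fun i _ => Finset.sum_congr rfl fun j _ => ?_
    split_ifs <;> simp
  linarith

/-- Points of `range n` within distance `r` of a block boundary. -/
lemma card_near_aux (n l r : ℕ) (hl : 1 ≤ l) :
    ((Finset.range n).filter (fun j => j % l < r ∨ l - 1 - j % l < r)).card
      ≤ 2 * ((n / l + 1) * r) := by
  rw [Finset.filter_or]
  refine (Finset.card_union_le _ _).trans ?_
  have key : ∀ f : ℕ → ℕ, (∀ i j, i / l = j / l → f i = f j → i = j) →
      ((Finset.range n).filter (fun j => f j < r)).card ≤ (n / l + 1) * r := by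
    intro f hf
    have : (Finset.range (n / l + 1) ×ˢ Finset.range r).card = (n / l + 1) * r := by simp
    rw [← this]
    refine Finset.card_le_card_of_injOn (fun j => (j / l, f j)) ?_ ?_
    · intro j hj
      simp only [Finset.coe_filter, Finset.mem_range, Set.mem_ofPred_eq] at hj
      simp only [Finset.coe_product, Set.mem_prod, Finset.coe_range, Set.mem_Iio]
      exact ⟨Nat.lt_succ_of_le (Nat.div_le_div_right hj.1.le), hj.2⟩
    · intro i _ j _ h
      rw [Prod.mk.injEq] at h
      exact hf i j h.1 h.2
  have k1 := key (fun j => j % l) (by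
    intro i j h1 h2
    rw [← Nat.div_add_mod i l, ← Nat.div_add_mod j l, h1]
    rw [h2])
  have k2 := key (fun j => l - 1 - j % l) (by
    intro i j h1 h2
    have a := Nat.mod_lt i hl
    have b := Nat.mod_lt j hl
    have h3 : i % l = j % l := by
      omega
    rw [← Nat.div_add_mod i l, ← Nat.div_add_mod j l, h1, h3])
  omega

lemma near_aux (i j l r : ℕ) (hl : 1 ≤ l) (hne : i / l ≠ j / l)
    (h : ((i : ℤ) - (j : ℤ)).natAbs < r) : j % l < r ∨ l - 1 - j % l < r := by
  have hi := Nat.div_add_mod i l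
  have hj := Nat.div_add_mod j l
  have a := Nat.mod_lt i hl
  have b := Nat.mod_lt j hl
  rcases lt_or_gt_of_ne hne with h1 | h1
  · left
    have := Nat.mul_le_mul_left l (Nat.succ_le_of_lt h1)
    rw [Nat.mul_succ] at this
    omega
  · right
    have := Nat.mul_le_mul_left l (Nat.succ_le_of_lt h1)
    rw [Nat.mul_succ] at this
    omega

lemma offblock_bound_aux (c : ℕ → ℕ → ℝ) (hc : ∀ i j, 0 ≤ c i j) (u : ℕ → ℝ)
    (husum : ∀ j r : ℕ, Summable
      (fun i : ℕ => if r ≤ ((i : ℤ) - (j : ℤ)).natAbs then c i j else 0))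
    (hubd : ∀ r : ℕ, 1 ≤ r → ∀ j : ℕ,
      (∑' i : ℕ, if r ≤ ((i : ℤ) - (j : ℤ)).natAbs then c i j else 0) ≤ u r)
    (n l r : ℕ) (hl : 1 ≤ l) (hr : 1 ≤ r) :
    (∑ j ∈ Finset.range n, ∑ i ∈ Finset.range n, if i / l = j / l then 0 else c i j)
      ≤ n * u r + 2 * (((n / l : ℕ) + 1) * r) * u 1 := by
  have hfin : ∀ r : ℕ, 1 ≤ r → ∀ j : ℕ, (∑ i ∈ Finset.range n,
      if r ≤ ((i : ℤ) - (j : ℤ)).natAbs then c i j else 0) ≤ u r := by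
    intro r hr j
    refine ((husum j r).sum_le_tsum _ fun i _ => ?_).trans (hubd r hr j)
    split_ifs
    · exact hc i j
    · exact le_rfl
  have hu1 : 0 ≤ u 1 := by
    refine le_trans (Finset.sum_nonneg fun i _ => ?_) (hfin 1 le_rfl 0)
    split_ifs
    · exact hc i 0
    · exact le_rfl
  have hj : ∀ j ∈ Finset.range n,
      (∑ i ∈ Finset.range n, if i / l = j / l then 0 else c i j)
      ≤ u r + if j % l < r ∨ l - 1 - j % l < r then u 1 else 0 := by
    intro j _
    by_cases hP : j % l < r ∨ l - 1 - j % l < r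
    · rw [if_pos hP]
      have : (∑ i ∈ Finset.range n, if i / l = j / l then 0 else c i j) ≤ 
          ∑ i ∈ Finset.range n, ((if r ≤ ((i : ℤ) - (j : ℤ)).natAbs then c i j else 0) +
            if 1 ≤ ((i : ℤ) - (j : ℤ)).natAbs then c i j else 0) := by
        refine Finset.sum_le_sum fun i _ => ?_
        have h0 := hc i j
        by_cases hij : i = j
        · subst hij
          rw [if_pos rfl]
          split_ifs <;> linarith
        · have : 1 ≤ ((i : ℤ) - (j : ℤ)).natAbs := by omega
          rw [if_pos this]
          split_ifs <;> linarith
      rw [Finset.sum_add_distrib] at this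
      linarith [hfin r hr j, hfin 1 le_rfl j]
    · rw [if_neg hP, add_zero]
      refine le_trans (Finset.sum_le_sum fun i _ => ?_) (hfin r hr j)
      have h0 := hc i j
      by_cases hij : i / l = j / l
      · rw [if_pos hij]
        split_ifs <;> linarith
      · rw [if_neg hij, if_pos]
        by_contra hlt
        exact hP (near_aux i j l r hl hij (not_le.1 hlt))
  refine (Finset.sum_le_sum hj).trans ?_
  rw [Finset.sum_add_distrib, Finset.sum_const, Finset.card_range, nsmul_eq_mul,
    ← Finset.sum_filter, Finset.sum_const, nsmul_eq_mul]
  have hcard : (((Finset.range n).filter (fun j => j % l < r ∨ l - 1 - j % l < r)).card : ℝ)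
      ≤ 2 * (((n / l : ℕ) + 1) * r) := by
    exact_mod_cast card_near_aux n l r hl
  have := mul_le_mul_of_nonneg_right hcard hu1
  linarith

/-- Under the Cox-coefficient condition and `inf_n sₙ²/n > 0`, with blocks of length
`ℓ(n) → ∞`, `ℓ(n)/n → 0` and `m(n) = ⌊n/ℓ(n)⌋`, the variance of `Sₙ` is asymptotically
the sum of the block variances plus the variance of the remainder:
`(1/sₙ²)(Var(Sₙ) − ∑ⱼ Var(B_{j,n}) − Var(Sₙ − S_{m(n)ℓ(n)})) → 0`. -/
theorem block_variance_decomposition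
    {Ω : Type*} [MeasurableSpace Ω] (μ : Measure Ω) [IsProbabilityMeasure μ]
    (X : ℕ → Ω → ℝ)
    (hmeas : ∀ i, Measurable (X i))
    (hL2 : ∀ i, MemLp (X i) 2 μ)
    (hmean : ∀ i, ∫ ω, X i ω ∂μ = 0)
    (hassoc : IsAssociatedSeq μ X)
    (S : ℕ → Ω → ℝ)
    (hS : ∀ n ω, S n ω = ∑ i ∈ Finset.range n, X i ω)
    (hinf : ∃ c : ℝ, 0 < c ∧ ∀ n : ℕ, 1 ≤ n → c ≤ variance (S n) μ / n)
    (u : ℕ → ℝ)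
    (hu : Tendsto u atTop (𝓝 0))
    (husum : ∀ j r : ℕ, Summable
      (fun i : ℕ => if r ≤ ((i : ℤ) - (j : ℤ)).natAbs then cov μ (X i) (X j) else 0))
    (hubd : ∀ r : ℕ, 1 ≤ r → ∀ j : ℕ,
      (∑' i : ℕ, if r ≤ ((i : ℤ) - (j : ℤ)).natAbs then cov μ (X i) (X j) else 0) ≤ u r)
    (ℓ m : ℕ → ℕ)
    (hℓ1 : ∀ n, 1 ≤ ℓ n)
    (hℓ_top : Tendsto ℓ atTop atTop)
    (hℓn : Tendsto (fun n => (ℓ n : ℝ) / n) atTop (𝓝 0))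
    (hm : ∀ n, m n = n / ℓ n)
    (B : ℕ → ℕ → Ω → ℝ)
    (hB : ∀ j n ω, B j n ω = S (j * ℓ n) ω - S ((j - 1) * ℓ n) ω) :
    Tendsto
      (fun n =>
        (variance (S n) μ
          - ∑ j ∈ Finset.Icc 1 (m n), variance (B j n) μ
          - variance (fun ω => S n ω - S (m n * ℓ n) ω) μ) / variance (S n) μ)
      atTop (𝓝 0) := by
  have hc := cov_nonneg_aux μ X hL2 hassoc
  have hcomm : ∀ i j, cov μ (X i) (X j) = cov μ (X j) (X i) := by
    intro i j
    simp only [cov, mul_comm]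
  have hSfun : ∀ n, S n = fun ω => ∑ i ∈ Finset.range n, X i ω := fun n => funext (hS n)
  have hdiff : ∀ a b, a ≤ b → (fun ω => S b ω - S a ω) = fun ω => ∑ i ∈ Finset.Ico a b, X i ω := by
    intro a b hab
    funext ω
    rw [hS, hS, Finset.sum_Ico_eq_sub _ hab]
  have hnum : ∀ n, variance (S n) μ
          - ∑ j ∈ Finset.Icc 1 (m n), variance (B j n) μ
          - variance (fun ω => S n ω - S (m n * ℓ n) ω) μ
      = ∑ j ∈ Finset.range n, ∑ i ∈ Finset.range n,
          if i / ℓ n = j / ℓ n then 0 else cov μ (X i) (X j) := by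
    intro n
    have hBv : ∀ j, variance (B j n) μ = ∑ a ∈ Finset.Ico ((j - 1) * ℓ n) (j * ℓ n),
        ∑ b ∈ Finset.Ico ((j - 1) * ℓ n) (j * ℓ n), cov μ (X b) (X a) := by
      intro j
      rw [show B j n = fun ω => S (j * ℓ n) ω - S ((j - 1) * ℓ n) ω from funext (hB j n),
        hdiff _ _ (Nat.mul_le_mul_right _ (Nat.sub_le _ _)), var_sum_aux μ X hL2, Finset.sum_comm]
    rw [hdiff _ _ (by rw [hm]; exact Nat.div_mul_le_self _ _), var_sum_aux μ X hL2, hSfun n,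
      var_sum_aux μ X hL2, Finset.sum_congr rfl fun j _ => hBv j, hm,
      ← block_decomp_aux (fun j i => cov μ (X i) (X j)) n (ℓ n) (hℓ1 n)]
    simp only [hcomm]
  simp only [hnum]
  obtain ⟨c, hcpos, hcn⟩ := hinf
  have hv : ∀ n : ℕ, 1 ≤ n → c * n ≤ variance (S n) μ := by
    intro n hn
    have hn' : (0 : ℝ) < n := by exact_mod_cast hn
    exact (le_div_iff₀ hn').1 (hcn n hn)
  have hnn : ∀ n, 0 ≤ ∑ j ∈ Finset.range n, ∑ i ∈ Finset.range n,
          if i / ℓ n = j / ℓ n then 0 else cov μ (X i) (X j) := by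
    intro n
    refine Finset.sum_nonneg fun j _ => Finset.sum_nonneg fun i _ => ?_
    split_ifs
    · exact le_rfl
    · exact hc i j
  have hb := fun n r hr => offblock_bound_aux (fun i j => cov μ (X i) (X j)) hc u husum hubd
    n (ℓ n) r (hℓ1 n) hr
  have hu1 : 0 ≤ u 1 := by
    refine le_trans (tsum_nonneg fun i => ?_) (hubd 1 le_rfl 0)
    split_ifs
    · exact hc i 0
    · exact le_rfl
  rw [Metric.tendsto_atTop]
  intro ε hε
  have hcε : 0 < c * ε := mul_pos hcpos hε
  obtain ⟨r, hur, hr⟩ := ((hu.eventually_lt_const (half_pos hcε)).and (eventually_ge_atTop 1)).exists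
  have hlim : Tendsto (fun n : ℕ => 2 * (((ℓ n : ℝ))⁻¹ + ((n : ℝ))⁻¹) * r * u 1) atTop (𝓝 0) := by
    have h1 : Tendsto (fun n : ℕ => ((ℓ n : ℝ))⁻¹) atTop (𝓝 0) :=
      tendsto_inv_atTop_zero.comp (tendsto_natCast_atTop_atTop.comp hℓ_top)
    have h2 : Tendsto (fun n : ℕ => ((n : ℝ))⁻¹) atTop (𝓝 0) :=
      tendsto_inv_atTop_zero.comp tendsto_natCast_atTop_atTop
    simpa using ((((h1.add h2).const_mul 2).mul_const (r : ℝ)).mul_const (u 1))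
  obtain ⟨N, hN⟩ := eventually_atTop.1
    ((hlim.eventually_lt_const (half_pos hcε)).and (eventually_ge_atTop 1))
  refine ⟨N, fun n hnN => ?_⟩
  obtain ⟨hn2, hn1⟩ := hN n hnN
  have hn' : (0 : ℝ) < n := by exact_mod_cast hn1
  have hvpos : 0 < variance (S n) μ := lt_of_lt_of_le (mul_pos hcpos hn') (hv n hn1)
  rw [Real.dist_eq, sub_zero, abs_of_nonneg (div_nonneg (hnn n) hvpos.le), div_lt_iff₀ hvpos]
  have hdiv : ((n / ℓ n : ℕ) : ℝ) ≤ n / ℓ n := Nat.cast_div_le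
  have e1 : 2 * ((((n / ℓ n : ℕ) : ℝ) + 1) * r) * u 1
      ≤ n * (2 * (((ℓ n : ℝ))⁻¹ + ((n : ℝ))⁻¹) * r * u 1) := by
    have : n * (2 * (((ℓ n : ℝ))⁻¹ + ((n : ℝ))⁻¹) * r * u 1)
        = 2 * (((n : ℝ) / ℓ n + 1) * r) * u 1 := by
      field_simp
    rw [this]
    gcongr
  have e2 := hb n r hr
  have e3 := mul_lt_mul_of_pos_left hn2 hn'
  have e4 := mul_lt_mul_of_pos_left hur hn'
  have e5 := mul_le_mul_of_nonneg_left (hv n hn1) hε.le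
  linarith
end
end
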